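/- (Hypograph tangency for viscosity subsolutions) Let L : ℝⁿ × ℝⁿ → [0,∞) be continuous and let W : (0,∞) × ℝⁿ → [0,∞) be continuous and satisfy p_t + H(x,−p_x) ≤ 0 for all (p_t,p_x) ∈ ∂₊W(t,x) and all t > 0, where H(x,p) = sup_u(⟨p,u⟩ − L(x,u)). Define K := Hyp(W) ∪ ((−∞,0] × ℝⁿ × ℝ), where Hyp(W) = {(t,x,r) : t > 0, r ≤ W(t,x)}. Then for every (t,x,r) ∈ K and every u ∈ ℝⁿ, the vector (−1, u, −L(x,u)) belongs to the closed convex hull of the contingent cone T_K(t,x,r). -/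

import Mathlib

open Filter Topology Metric Set
open scoped RealInnerProductSpace

noncomputable section

abbrev Euc (n : ℕ) := EuclideanSpace ℝ (Fin n)

def contCone {F : Type*} [NormedAddCommGroup F] [NormedSpace ℝ F] (K : Set F) (x : F) : Set F :=
  {v | ∀ ε > 0, ∃ h : ℝ, 0 < h ∧ h < ε ∧ Metric.infDist (x + h • v) K < ε * h}

def Dup {F : Type*} [NormedAddCommGroup F] [NormedSpace ℝ F]
    (W : F → EReal) (x u : F) : EReal :=
  Filter.liminf (fun p : ℝ × F => ((p.1⁻¹ : ℝ) : EReal) * (W (x + p.1 • p.2) - W x))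
    ((𝓝[>] (0:ℝ)) ×ˢ 𝓝 u)

def Ham {n : ℕ} (L : Euc n → Euc n → ℝ) (x p : Euc n) : EReal :=
  ⨆ u : Euc n, ((⟪p, u⟫ - L x u : ℝ) : EReal)

def subdiffP {n : ℕ} (W : ℝ × Euc n → EReal) (q : ℝ × Euc n) : Set (ℝ × Euc n) :=
  {p | ∀ ε > 0, ∀ᶠ z in 𝓝 q,
    W q + ((p.1 * (z.1 - q.1) + ⟪p.2, z.2 - q.2⟫ - ε * ‖z - q‖ : ℝ) : EReal) ≤ W z}

def bolzaValue {n : ℕ} (L : Euc n → Euc n → ℝ) (φ : Euc n → EReal) (t : ℝ) (x : Euc n) : EReal :=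
  sInf {c : EReal | ∃ u : ℝ → Euc n,
    IntervalIntegrable u MeasureTheory.volume 0 t ∧
    IntervalIntegrable (fun s => L (x + ∫ τ in (0:ℝ)..s, u τ) (u s)) MeasureTheory.volume 0 t ∧
    c = ((∫ s in (0:ℝ)..t, L (x + ∫ τ in (0:ℝ)..s, u τ) (u s) : ℝ) : EReal)
        + φ (x + ∫ τ in (0:ℝ)..t, u τ)}

def Superlinear {n : ℕ} (Θ : Euc n → ℝ) : Prop :=
  Filter.Tendsto (fun u : Euc n => Θ u / ‖u‖) (Filter.comap norm Filter.atTop) Filter.atTop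

def negPolar {n : ℕ} (T : Set (Euc n)) : Set (Euc n) :=
  {v | ∀ w ∈ T, ⟪v, w⟫ ≤ 0}

def rsubdiffP {n : ℕ} (W : ℝ × Euc n → ℝ) (q : ℝ × Euc n) : Set (ℝ × Euc n) :=
  {p | ∀ ε > 0, ∀ᶠ z in 𝓝 q,
    W q + (p.1 * (z.1 - q.1) + ⟪p.2, z.2 - q.2⟫) - ε * ‖z - q‖ ≤ W z}

def rsupdiffP {n : ℕ} (W : ℝ × Euc n → ℝ) (q : ℝ × Euc n) : Set (ℝ × Euc n) :=
  {p | ∀ ε > 0, ∀ᶠ z in 𝓝 q,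
    W z ≤ W q + (p.1 * (z.1 - q.1) + ⟪p.2, z.2 - q.2⟫) + ε * ‖z - q‖}

theorem mem_contCone_of_eventually_mem {F : Type*} [NormedAddCommGroup F] [NormedSpace ℝ F]
    {K : Set F} {x v : F} (h : ∀ᶠ s : ℝ in 𝓝[>] 0, x + s • v ∈ K) : v ∈ contCone K x := by
  intro ε hε
  obtain ⟨s, hs, hs0, hsε⟩ := (h.and (Ioo_mem_nhdsGT hε)).exists
  refine ⟨s, hs0, hsε, ?_⟩
  rw [Metric.infDist_zero_of_mem hs]
  positivity

theorem smul_mem_contCone {F : Type*} [NormedAddCommGroup F] [NormedSpace ℝ F]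
    {K : Set F} {x v : F} (hv : v ∈ contCone K x) {c : ℝ} (hc : 0 < c) :
    c • v ∈ contCone K x := by
  intro ε hε
  obtain ⟨h, h0, hlt, hd⟩ := hv (min (c * ε) (ε / c)) (by positivity)
  refine ⟨h / c, by positivity, ?_, ?_⟩
  · rw [div_lt_iff₀ hc, mul_comm]
    exact hlt.trans_le (min_le_left _ _)
  · rw [smul_smul, div_mul_cancel₀ _ hc.ne']
    calc _ < _ := hd
      _ ≤ ε / c * h := by gcongr; exact min_le_right _ _
      _ = ε * (h / c) := by ring

/-- In finite dimension, the negative polar of the contingent cone consists of Fréchet normals. -/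
theorem eventually_le_norm_of_nonpos_on_contCone {F : Type*} [NormedAddCommGroup F]
    [NormedSpace ℝ F] [FiniteDimensional ℝ F] {K : Set F} {x : F} (f : F →L[ℝ] ℝ)
    (hf : ∀ v ∈ contCone K x, f v ≤ 0) {ε : ℝ} (hε : 0 < ε) :
    ∀ᶠ y in 𝓝 x, y ∈ K → f (y - x) ≤ ε * ‖y - x‖ := by
  by_contra hcon
  have hfreq : ∃ᶠ y in 𝓝 x, y ∈ K ∧ ε * ‖y - x‖ < f (y - x) := by
    refine (Filter.not_eventually.mp hcon).mono fun y hy => ?_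
    push Not at hy
    exact hy
  have hpos : ∀ y, ε * ‖y - x‖ < f (y - x) → 0 < ‖y - x‖ := by
    intro y hy
    rw [norm_pos_iff]
    intro h0
    simp [h0] at hy
  set d : F → F := fun y => ‖y - x‖⁻¹ • (y - x) with hd
  set l : Filter F := 𝓝 x ⊓ 𝓟 {y | y ∈ K ∧ ε * ‖y - x‖ < f (y - x)} with hl
  have hne : l.NeBot := by
    rw [hl, ← Filter.frequently_mem_iff_neBot]
    exact hfreq
  have hbad : ∀ᶠ y in l, y ∈ K ∧ ε * ‖y - x‖ < f (y - x) :=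
    mem_inf_of_right (mem_principal_self _)
  have hsph : ∀ᶠ y in l, d y ∈ Metric.sphere (0 : F) 1 := by
    filter_upwards [hbad] with y hy
    have := hpos y hy.2
    simp [hd, norm_smul, this.ne']
  obtain ⟨w, -, hw⟩ := (isCompact_sphere (0 : F) 1).exists_mapClusterPt_of_frequently
    hsph.frequently
  rw [mapClusterPt_iff_frequently] at hw
  have hwT : w ∈ contCone K x := by
    intro δ hδ
    have hnear : ∀ᶠ y in l, y ∈ Metric.ball x δ := mem_inf_of_left (Metric.ball_mem_nhds x hδ)
    obtain ⟨y, hyd, hyn, hyK, hyf⟩ :=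
      ((hw _ (Metric.ball_mem_nhds w hδ)).and_eventually (hnear.and hbad)).exists
    have h0 := hpos y hyf
    refine ⟨‖y - x‖, h0, by simpa [dist_eq_norm] using hyn, ?_⟩
    refine (Metric.infDist_le_dist_of_mem hyK).trans_lt ?_
    have hy : y = x + ‖y - x‖ • d y := by
      simp [hd, smul_smul, h0.ne']
    have : dist (x + ‖y - x‖ • w) y = dist (d y) w * ‖y - x‖ := by
      calc dist (x + ‖y - x‖ • w) y = dist (x + ‖y - x‖ • w) (x + ‖y - x‖ • d y) := by
            rw [← hy]
        _ = dist (d y) w * ‖y - x‖ := by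
            rw [dist_add_left, dist_smul₀, dist_comm, mul_comm, norm_norm]
    rw [this]
    exact mul_lt_mul_of_pos_right hyd h0
  have hlt : ∀ᶠ v in 𝓝 w, f v < ε :=
    (f.continuous.tendsto w).eventually_lt_const ((hf w hwT).trans_lt hε)
  obtain ⟨y, hyf, -, hy⟩ := ((hw _ hlt).and_eventually hbad).exists
  have h0 := hpos y hy
  have hyf' : ‖y - x‖⁻¹ * f (y - x) < ε := by simpa [hd] using hyf
  rw [inv_mul_lt_iff₀ h0] at hyf'
  linarith [mul_comm ε ‖y - x‖]

theorem mem_rsupdiffP_of_le_of_hasFDerivAt {n : ℕ} {W F : ℝ × Euc n → ℝ} {q p : ℝ × Euc n}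
    {F' : ℝ × Euc n →L[ℝ] ℝ} (hF : HasFDerivAt F F' q)
    (hF' : ∀ v, F' v = p.1 * v.1 + ⟪p.2, v.2⟫) (hle : ∀ᶠ z in 𝓝 q, W z ≤ F z)
    (heq : W q = F q) : p ∈ rsupdiffP W q := by
  intro ε hε
  filter_upwards [hle, hF.isLittleO.def hε] with z hz hz'
  have h1 := (abs_le.mp hz').2
  have h2 := hF' (z - q)
  simp only [Prod.fst_sub, Prod.snd_sub] at h2
  rw [heq]
  linarith

/-- Fréchet normals to the hypograph with positive vertical component yield superdifferentials. -/
theorem mem_rsupdiffP_of_nonpos_on_contCone {n : ℕ} {W : ℝ × Euc n → ℝ}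
    {K : Set ((ℝ × Euc n) × ℝ)} {q : ℝ × Euc n}
    (hK : ∀ᶠ z in 𝓝 q, ∀ r ≤ W z, (z, r) ∈ K)
    {a c : ℝ} {b : Euc n} (hc : 0 < c) {f : (ℝ × Euc n) × ℝ →L[ℝ] ℝ}
    (hf : ∀ v, f v = a * v.1.1 + ⟪b, v.1.2⟫ + c * v.2)
    (hfT : ∀ v ∈ contCone K (q, W q), f v ≤ 0) :
    (-(a / c), -((1 / c) • b)) ∈ rsupdiffP W q := by
  intro ε hε
  set ℓ : ℝ × Euc n →L[ℝ] ℝ :=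
    (-(1 / c)) • (f.comp (ContinuousLinearMap.inl ℝ (ℝ × Euc n) ℝ)) with hℓ
  have hℓv : ∀ v : ℝ × Euc n, ℓ v = -(a / c) * v.1 + ⟪-((1 / c) • b), v.2⟫ := by
    intro v
    simp only [hℓ, smul_apply, ContinuousLinearMap.comp_apply,
      ContinuousLinearMap.inl_apply, hf, inner_neg_left, real_inner_smul_left, smul_eq_mul]
    ring
  set C : ℝ := 1 + ‖ℓ‖ + ε with hC
  have hC0 : 0 < C := by positivity
  have hδ : 0 < c * ε / (2 * C) := by positivity
  have htend : Tendsto (fun z : ℝ × Euc n => (z, W q + (ℓ (z - q) + ε * ‖z - q‖))) (𝓝 q)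
      (𝓝 (q, W q)) := by
    have : Continuous (fun z : ℝ × Euc n => (z, W q + (ℓ (z - q) + ε * ‖z - q‖))) := by
      fun_prop
    simpa using this.tendsto q
  filter_upwards [hK, htend.eventually (eventually_le_norm_of_nonpos_on_contCone f hfT hδ)]
    with z hzK hz
  by_contra! hlt
  have h1 := hℓv (z - q)
  simp only [Prod.fst_sub, Prod.snd_sub] at h1
  have hz' := hz (hzK _ (by linarith))
  have hzq : 0 < ‖z - q‖ := by
    rw [norm_pos_iff, sub_ne_zero]
    rintro rfl
    simp at hlt
  have hval : f ((z, W q + (ℓ (z - q) + ε * ‖z - q‖)) - (q, W q)) = c * ε * ‖z - q‖ := by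
    rw [hf]
    simp only [Prod.fst_sub, Prod.snd_sub, h1, inner_neg_left, real_inner_smul_left]
    field_simp
    ring
  have hnorm : ‖(z, W q + (ℓ (z - q) + ε * ‖z - q‖)) - (q, W q)‖ ≤ C * ‖z - q‖ := by
    rw [Prod.norm_def]
    simp only [Prod.fst_sub, Prod.snd_sub, add_sub_cancel_left]
    have h2 : ‖ℓ (z - q) + ε * ‖z - q‖‖ ≤ ‖ℓ‖ * ‖z - q‖ + ε * ‖z - q‖ :=
      (norm_add_le _ _).trans (add_le_add (ℓ.le_opNorm _) (by simp [abs_of_pos hε]))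
    apply max_le <;> nlinarith [mul_nonneg (norm_nonneg ℓ) hzq.le, mul_pos hε hzq]
  rw [hval] at hz'
  have h3 : c * ε * ‖z - q‖ ≤ c * ε / (2 * C) * (C * ‖z - q‖) := hz'.trans (by gcongr)
  have h4 : c * ε / (2 * C) * (C * ‖z - q‖) = c * ε * ‖z - q‖ / 2 := by field_simp
  nlinarith [mul_pos (mul_pos hc hε) hzq]

/-- An interior maximizer of `A + ε θ(W - w₀)`, for the increasing function
`θ s = s - √(s ^ 2 + κ ^ 2)`, gives a superdifferential of `W`. -/
theorem exists_mem_rsupdiffP_of_isLocalMax {n : ℕ} {W A : ℝ × Euc n → ℝ} {q : ℝ × Euc n}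
    {a : ℝ} {b : Euc n} {A' : ℝ × Euc n →L[ℝ] ℝ} (hA : HasFDerivAt A A' q)
    (hA' : ∀ v, A' v = a * v.1 + ⟪b, v.2⟫) {ε κ w₀ : ℝ} (hε : 0 < ε) (hκ : 0 < κ)
    (hmax : IsLocalMax
      (fun z => A z + ε * ((W z - w₀) - √((W z - w₀) ^ 2 + κ ^ 2))) q) :
    ∃ c, 0 < c ∧ c ≤ 2 * ε ∧ (-(a / c), -((1 / c) • b)) ∈ rsupdiffP W q := by
  set Y : ℝ → ℝ := fun s => √(s ^ 2 + κ ^ 2) - s with hY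
  have hYpos : ∀ s, 0 < Y s := by
    intro s
    have : s < √(s ^ 2 + κ ^ 2) := Real.lt_sqrt_of_sq_lt (by nlinarith [sq_pos_of_pos hκ])
    simp only [hY]; linarith
  have hYinv : ∀ s, s = (κ ^ 2 / Y s - Y s) / 2 := by
    intro s
    have h1 := Real.sq_sqrt (show 0 ≤ s ^ 2 + κ ^ 2 by positivity)
    have h2 := (hYpos s).ne'
    field_simp
    simp only [hY]
    nlinarith
  set y₀ := Y (W q - w₀) with hy₀
  have hy₀pos : 0 < y₀ := hYpos _
  set y : ℝ × Euc n → ℝ := fun z => y₀ + ε⁻¹ * (A z - A q) with hy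
  have hyq : y q = y₀ := by simp [hy]
  have hyd : HasFDerivAt y (ε⁻¹ • A') q := ((hA.sub_const (A q)).const_mul ε⁻¹).const_add y₀
  have hycont : ∀ᶠ z in 𝓝 q, 0 < y z :=
    hyd.continuousAt.eventually (lt_mem_nhds (by rw [hyq]; exact hy₀pos))
  have hβ : HasDerivAt (fun t : ℝ => w₀ + (κ ^ 2 / t - t) / 2)
      (-((κ ^ 2 / y₀ ^ 2 + 1) / 2)) (y q) := by
    rw [hyq]
    have h1 := ((((hasDerivAt_inv hy₀pos.ne').const_mul (κ ^ 2)).sub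
      (hasDerivAt_id y₀)).div_const 2).const_add w₀
    refine h1.congr_deriv ?_
    field_simp
    ring
  have hcomp := hβ.comp_hasFDerivAt q hyd
  have hc : 0 < 2 * ε / (κ ^ 2 / y₀ ^ 2 + 1) := by positivity
  refine ⟨2 * ε / (κ ^ 2 / y₀ ^ 2 + 1), hc, ?_, ?_⟩
  · apply div_le_self (by positivity)
    have : 0 ≤ κ ^ 2 / y₀ ^ 2 := by positivity
    linarith
  · refine mem_rsupdiffP_of_le_of_hasFDerivAt hcomp ?_ ?_ ?_
    · intro v
      simp only [smul_apply, hA', inner_neg_left, real_inner_smul_left,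
        smul_eq_mul]
      field_simp
      ring
    · filter_upwards [hmax, hycont] with z hz hzpos
      have hle : y z ≤ Y (W z - w₀) := by
        have h1 : A z - A q ≤ ε * (Y (W z - w₀) - y₀) := by
          simp only [hy₀, hY]; linarith
        have h2 : ε⁻¹ * (A z - A q) ≤ Y (W z - w₀) - y₀ := by
          rwa [inv_mul_le_iff₀ hε]
        simp only [hy]; linarith
      have h3 := hYinv (W z - w₀)
      have h4 : κ ^ 2 / Y (W z - w₀) ≤ κ ^ 2 / y z := by gcongr
      simp only [Function.comp]
      linarith
    · have h3 := hYinv (W q - w₀)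
      simp only [Function.comp, hyq]
      linarith

/-- Rockafellar's horizontal approximation: a horizontal Fréchet normal to the hypograph is a limit
of normals with positive vertical component at nearby points. -/
theorem exists_mem_rsupdiffP_near_horizontal_normal {n : ℕ} {W : ℝ × Euc n → ℝ} {q : ℝ × Euc n}
    {a : ℝ} {b : Euc n} {P : ℝ × Euc n → Prop} (hP : ∀ᶠ z in 𝓝 q, P z)
    (hW : ∀ᶠ z in 𝓝 q, ContinuousAt W z)
    (hnormal : ∀ ε > 0, ∀ᶠ z in 𝓝 q,
      a * (z.1 - q.1) + ⟪b, z.2 - q.2⟫ ≤ ε * (‖z - q‖ + max (W q - W z) 0))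
    {η : ℝ} (hη : 0 < η) :
    ∃ z, P z ∧ ∃ c a' b', 0 < c ∧ c ≤ η ∧ |a' - a| ≤ 2 * η ∧ ‖b' - b‖ ≤ 2 * η ∧
      (-(a' / c), -((1 / c) • b')) ∈ rsupdiffP W z := by
  obtain ⟨R, hR, hball⟩ := Metric.nhds_basis_closedBall.eventually_iff.mp
    (hP.and (hW.and (hnormal (η / 2) (by positivity))))
  set A : ℝ × Euc n → ℝ := fun z => a * (z.1 - q.1) + ⟪b, z.2 - q.2⟫
    - η / R * ((z.1 - q.1) ^ 2 + ‖z.2 - q.2‖ ^ 2) with hA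
  have hκ : 0 < R / 2 := by positivity
  have hη2 : 0 < η / 2 := by positivity
  set g : ℝ × Euc n → ℝ := fun z =>
    A z + η / 2 * ((W z - W q) - √((W z - W q) ^ 2 + (R / 2) ^ 2)) with hg
  have hWc : ContinuousOn W (Metric.closedBall q R) := fun z hz =>
    (hball hz).2.1.continuousWithinAt
  have hgc : ContinuousOn g (Metric.closedBall q R) := by
    have hAc : Continuous A := by fun_prop
    have := hAc.continuousOn (s := Metric.closedBall q R)
    fun_prop
  obtain ⟨z, hz, hzmax⟩ := (isCompact_closedBall q R).exists_isMaxOn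
    (Metric.nonempty_closedBall.mpr hR.le) hgc
  have hgq : g q = -(η * R / 4) := by
    simp only [hg, hA, sub_self, mul_zero, inner_zero_right, norm_zero]
    rw [show (0 : ℝ) ^ 2 + (R / 2) ^ 2 = (R / 2) ^ 2 by ring, Real.sqrt_sq hκ.le]
    ring
  have hgz : -(η * R / 4) ≤ g z := hgq ▸ hzmax (Metric.mem_closedBall_self hR.le)
  have hznorm : ‖z - q‖ ≤ R := by simpa [dist_eq_norm] using hz
  have hz1 : |z.1 - q.1| ≤ R := (norm_fst_le (z - q)).trans hznorm
  have hz2 : ‖z.2 - q.2‖ ≤ R := (norm_snd_le (z - q)).trans hznorm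
  have hint : z ∈ Metric.ball q R := by
    rw [Metric.mem_ball, dist_eq_norm]
    by_contra! hge
    have hN : R ^ 2 ≤ (z.1 - q.1) ^ 2 + ‖z.2 - q.2‖ ^ 2 := by
      rw [Prod.norm_def, le_max_iff] at hge
      simp only [Prod.fst_sub, Prod.snd_sub, Real.norm_eq_abs] at hge
      rcases hge with h | h
      · nlinarith [sq_abs (z.1 - q.1), sq_nonneg ‖z.2 - q.2‖]
      · nlinarith [sq_nonneg (z.1 - q.1)]
    have hpen : η * R ≤ η / R * ((z.1 - q.1) ^ 2 + ‖z.2 - q.2‖ ^ 2) := by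
      calc η * R = η / R * R ^ 2 := by field_simp
        _ ≤ _ := by gcongr
    have hn := (hball hz).2.2
    have hθ : (W z - W q) - √((W z - W q) ^ 2 + (R / 2) ^ 2) ≤ -max (W q - W z) 0 := by
      have h1 : |W z - W q| ≤ √((W z - W q) ^ 2 + (R / 2) ^ 2) :=
        Real.abs_le_sqrt (by nlinarith [sq_nonneg (R / 2)])
      have h2 := le_abs_self (W z - W q)
      have h3 := abs_nonneg (W z - W q)
      rcases max_cases (W q - W z) 0 with ⟨h, _⟩ | ⟨h, _⟩ <;> rw [h] <;> linarith
    have hθ' := mul_le_mul_of_nonneg_left hθ hη2.le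
    have hn' : η / 2 * (‖z - q‖ + max (W q - W z) 0) ≤
        η / 2 * (R + max (W q - W z) 0) := by gcongr
    simp only [hg, hA] at hgz
    nlinarith [mul_pos hη hR]
  have hloc : IsLocalMax g z :=
    hzmax.isLocalMax
      (mem_of_superset (Metric.isOpen_ball.mem_nhds hint) Metric.ball_subset_closedBall)
  set a' := a - 2 * (η / R) * (z.1 - q.1) with ha'
  set b' := b - (2 * (η / R)) • (z.2 - q.2) with hb'
  have h1 : HasFDerivAt (fun z : ℝ × Euc n => z.1 - q.1)
      (ContinuousLinearMap.fst ℝ ℝ (Euc n)) z := hasFDerivAt_fst.sub_const _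
  have h2 : HasFDerivAt (fun z : ℝ × Euc n => z.2 - q.2)
      (ContinuousLinearMap.snd ℝ ℝ (Euc n)) z := hasFDerivAt_snd.sub_const _
  have hAd := ((h1.const_mul a).add ((hasFDerivAt_const b z).inner ℝ h2)).sub
    (((h1.pow 2).add h2.norm_sq).const_mul (η / R))
  have hratio : η / R * R = η := by field_simp
  obtain ⟨c, hc0, hc, hmem⟩ := exists_mem_rsupdiffP_of_isLocalMax (a := a') (b := b') hAd
    (by
      intro v
      simp [ha', hb', inner_sub_left, real_inner_smul_left, fderivInnerCLM_apply]
      ring) hη2 hκ hloc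
  refine ⟨z, (hball hz).1, c, a', b', hc0, by linarith, ?_, ?_, hmem⟩
  · rw [ha', sub_sub_cancel_left, abs_neg, abs_mul, abs_of_pos (by positivity)]
    nlinarith [mul_le_mul_of_nonneg_left hz1 (show 0 ≤ 2 * (η / R) by positivity)]
  · rw [hb', sub_sub_cancel_left, norm_neg, norm_smul, Real.norm_eq_abs,
      abs_of_pos (by positivity)]
    nlinarith [mul_le_mul_of_nonneg_left hz2 (show 0 ≤ 2 * (η / R) by positivity)]

theorem inner_sub_le_of_add_Ham_nonpos {n : ℕ} {L : Euc n → Euc n → ℝ} {x p u : Euc n} {s : ℝ}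
    (h : (s : ℝ) + Ham L x p ≤ (0 : EReal)) : s + (⟪p, u⟫ - L x u) ≤ 0 := by
  have h1 : ((⟪p, u⟫ - L x u : ℝ) : EReal) ≤ Ham L x p :=
    le_iSup (fun u : Euc n => ((⟪p, u⟫ - L x u : ℝ) : EReal)) u
  exact_mod_cast (add_le_add_right h1 (s : EReal)).trans h

theorem mem_closure_convexHull_contCone {F : Type*} [NormedAddCommGroup F] [NormedSpace ℝ F]
    {K : Set F} {x v : F} (hx : x ∈ K)
    (h : ∀ f : F →L[ℝ] ℝ, (∀ w ∈ contCone K x, f w ≤ 0) → f v ≤ 0) :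
    v ∈ closure (convexHull ℝ (contCone K x)) := by
  by_contra hv
  obtain ⟨f, s, hfs, hs⟩ :=
    geometric_hahn_banach_closed_point (convex_convexHull ℝ _).closure isClosed_closure hv
  have hT : ∀ w ∈ contCone K x, f w < s := fun w hw =>
    hfs w (subset_closure (subset_convexHull ℝ _ hw))
  have hs0 : 0 < s := by
    simpa using hT 0 (mem_contCone_of_eventually_mem (by simp [hx]))
  refine (hs0.trans hs).not_ge (h f fun w hw => ?_)
  by_contra! hpos
  have := hT _ (smul_mem_contCone hw (c := s / f w) (by positivity))
  rw [map_smul, smul_eq_mul, div_mul_cancel₀ _ hpos.ne'] at this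
  exact this.false

theorem exists_coeff_of_clm {n : ℕ} (f : (ℝ × Euc n) × ℝ →L[ℝ] ℝ) :
    ∃ a b c, ∀ v, f v = a * v.1.1 + ⟪b, v.1.2⟫ + c * v.2 := by
  set g : Euc n →L[ℝ] ℝ := (f.comp (ContinuousLinearMap.inl ℝ _ ℝ)).comp
    (ContinuousLinearMap.inr ℝ ℝ (Euc n)) with hg
  refine ⟨f ((1, 0), 0), (InnerProductSpace.toDual ℝ (Euc n)).symm g, f ((0, 0), 1), ?_⟩
  rintro ⟨⟨s, y⟩, r⟩
  have hv : (((s, y), r) : (ℝ × Euc n) × ℝ) =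
      s • ((1, 0), 0) + ((0, y), 0) + r • ((0, 0), 1) := by simp
  rw [InnerProductSpace.toDual_symm_apply, hv]
  simp only [map_add, map_smul, smul_eq_mul]
  simp [hg, mul_comm]

theorem stmt19 {n : ℕ} (L : Euc n → Euc n → ℝ) (W : ℝ × Euc n → ℝ)
    (hL0 : ∀ x u, 0 ≤ L x u)
    (hLc : Continuous (fun q : Euc n × Euc n => L q.1 q.2))
    (hW0 : ∀ q : ℝ × Euc n, 0 < q.1 → 0 ≤ W q)
    (hWc : ContinuousOn W {q : ℝ × Euc n | 0 < q.1})
    (hsub : ∀ t : ℝ, ∀ x : Euc n, 0 < t → ∀ p ∈ rsupdiffP W (t, x),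
      (p.1 : ℝ) + Ham L x (-p.2) ≤ (0 : EReal)) :
    ∀ z ∈ ({q : (ℝ × Euc n) × ℝ | 0 < q.1.1 ∧ q.2 ≤ W q.1} ∪
        {q : (ℝ × Euc n) × ℝ | q.1.1 ≤ 0}),
      ∀ u : Euc n,
        ((((-1 : ℝ), u), -(L z.1.2 u)) : (ℝ × Euc n) × ℝ) ∈
          closure (convexHull ℝ (contCone
            ({q : (ℝ × Euc n) × ℝ | 0 < q.1.1 ∧ q.2 ≤ W q.1} ∪
             {q : (ℝ × Euc n) × ℝ | q.1.1 ≤ 0}) z)) := by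
  set K : Set ((ℝ × Euc n) × ℝ) := {q : (ℝ × Euc n) × ℝ | 0 < q.1.1 ∧ q.2 ≤ W q.1} ∪
    {q : (ℝ × Euc n) × ℝ | q.1.1 ≤ 0} with hK
  rintro ⟨⟨t, x⟩, r⟩ hz u
  have hcone : ∀ {v}, v ∈ contCone K ((t, x), r) →
      v ∈ closure (convexHull ℝ (contCone K ((t, x), r))) := fun hv =>
    subset_closure (subset_convexHull ℝ _ hv)
  rcases le_or_gt t 0 with ht | ht
  · refine hcone (mem_contCone_of_eventually_mem ?_)
    filter_upwards [self_mem_nhdsWithin] with s hs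
    have hs : 0 < s := hs
    right
    simp only [mem_ofPred_eq, Prod.fst_add, Prod.smul_fst, smul_eq_mul]
    linarith
  have hpos : ∀ᶠ q : ℝ × Euc n in 𝓝 (t, x), 0 < q.1 :=
    continuous_fst.continuousAt.eventually (lt_mem_nhds ht)
  have hopen : IsOpen {q : ℝ × Euc n | 0 < q.1} := isOpen_lt continuous_const continuous_fst
  have hWat : ∀ q : ℝ × Euc n, 0 < q.1 → ContinuousAt W q := fun q hq =>
    hWc.continuousAt (hopen.mem_nhds hq)
  have hr : r ≤ W (t, x) := by
    rcases hz with h | h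
    · exact h.2
    · exact absurd ht (not_lt.mpr h)
  rcases hr.lt_or_eq with hlt | rfl
  · refine hcone (mem_contCone_of_eventually_mem ?_)
    have hcont : Continuous fun s : ℝ =>
        (((t, x), r) : (ℝ × Euc n) × ℝ) + s • (((-1 : ℝ), u), -(L x u)) := by fun_prop
    have htend := hcont.tendsto 0
    simp only [zero_smul, add_zero] at htend
    have hnear : ∀ᶠ y : (ℝ × Euc n) × ℝ in 𝓝 ((t, x), r), 0 < y.1.1 ∧ y.2 < W y.1 := by
      refine ((continuousAt_fst (p := ((t, x), r))).eventually hpos).and ?_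
      have h1 : ContinuousAt (fun y : (ℝ × Euc n) × ℝ => W y.1) ((t, x), r) :=
        ContinuousAt.comp (f := Prod.fst) (hWat (t, x) ht) continuousAt_fst
      exact continuousAt_snd.eventually_lt h1 hlt
    filter_upwards [(htend.mono_left nhdsWithin_le_nhds).eventually hnear] with s hs
    exact Or.inl ⟨hs.1, hs.2.le⟩
  refine mem_closure_convexHull_contCone hz fun f hfT => ?_
  obtain ⟨a, b, c, hf⟩ := exists_coeff_of_clm f
  have hKnear : ∀ᶠ z in 𝓝 (t, x), ∀ r ≤ W z, (z, r) ∈ K := by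
    filter_upwards [hpos] with z hz r hr using Or.inl ⟨hz, hr⟩
  have hc0 : 0 ≤ c := by
    have := hfT ((0, 0), -1) (mem_contCone_of_eventually_mem (by
      filter_upwards [self_mem_nhdsWithin] with s hs
      have hs : 0 < s := hs
      left
      simp [ht, hs.le]))
    rw [hf] at this
    simpa using this
  rcases hc0.lt_or_eq with hc | rfl
  · have hmem := mem_rsupdiffP_of_nonpos_on_contCone hKnear hc hf hfT
    have h := inner_sub_le_of_add_Ham_nonpos (u := u) (hsub t x ht _ hmem)
    simp only [neg_neg, real_inner_smul_left] at h
    have h' := mul_nonpos_of_nonneg_of_nonpos hc.le h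
    have h'' : c * (-(a / c) + (1 / c * ⟪b, u⟫ - L x u)) = -a + ⟪b, u⟫ - c * L x u := by
      field_simp
      ring
    rw [hf]
    simp only
    linarith
  · rw [hf]
    have hnormal : ∀ ε > 0, ∀ᶠ z : ℝ × Euc n in 𝓝 (t, x),
        a * (z.1 - (t, x).1) + ⟪b, z.2 - (t, x).2⟫ ≤
          ε * (‖z - (t, x)‖ + max (W (t, x) - W z) 0) := by
      intro ε hε
      have htend : Tendsto (fun z => (z, min (W z) (W (t, x)))) (𝓝 (t, x))
          (𝓝 ((t, x), W (t, x))) := by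
        have h1 : ContinuousAt (fun z => (z, min (W z) (W (t, x)))) (t, x) :=
          continuousAt_id.prodMk ((hWat _ ht).min continuousAt_const)
        simpa [ContinuousAt] using h1
      filter_upwards [hKnear,
        htend.eventually (eventually_le_norm_of_nonpos_on_contCone f hfT hε)] with z hzK hz
      have h1 := hz (hzK _ (min_le_left _ _))
      rw [hf] at h1
      simp only [Prod.fst_sub, Prod.snd_sub, zero_mul, add_zero] at h1
      refine h1.trans ?_
      gcongr
      rw [Prod.norm_def]
      have h2 : ‖min (W z) (W (t, x)) - W (t, x)‖ = max (W (t, x) - W z) 0 := by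
        rcases le_total (W z) (W (t, x)) with h | h
        · rw [min_eq_left h, max_eq_left (by linarith), Real.norm_eq_abs, abs_sub_comm,
            abs_of_nonneg (by linarith)]
        · rw [min_eq_right h, max_eq_right (by linarith)]
          simp
      simp only [Prod.fst_sub, Prod.snd_sub]
      rw [h2]
      exact max_le_add_of_nonneg (norm_nonneg _) (le_max_right _ _)
    have hLnear : ∀ᶠ z : ℝ × Euc n in 𝓝 (t, x), 0 < z.1 ∧ L z.2 u < L x u + 1 := by
      refine hpos.and ?_
      have hc : Continuous fun z : ℝ × Euc n => L z.2 u :=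
        hLc.comp (continuous_snd.prodMk continuous_const)
      exact (hc.tendsto (t, x)).eventually_lt_const (lt_add_one _)
    have key : ∀ η > 0, -a + ⟪b, u⟫ ≤ η * (2 + 2 * ‖u‖ + (L x u + 1)) := by
      intro η hη
      obtain ⟨z, ⟨hz1, hzL⟩, c, a', b', hc, hcη, ha', hb', hmem⟩ :=
        exists_mem_rsupdiffP_near_horizontal_normal hLnear
          (hpos.mono fun z hz => hWat z hz) hnormal hη
      have h := inner_sub_le_of_add_Ham_nonpos (u := u) (hsub z.1 z.2 hz1 _ hmem)
      simp only [neg_neg, real_inner_smul_left] at h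
      have h' := mul_nonpos_of_nonneg_of_nonpos hc.le h
      have h'' : c * (-(a' / c) + (1 / c * ⟪b', u⟫ - L z.2 u)) =
          -a' + ⟪b', u⟫ - c * L z.2 u := by
        field_simp
        ring
      have hcL : c * L z.2 u ≤ η * (L x u + 1) :=
        mul_le_mul hcη hzL.le (hL0 _ _) hη.le
      have hin : -(2 * η * ‖u‖) ≤ ⟪b' - b, u⟫ := by
        have h3 := (abs_le.mp (abs_real_inner_le_norm (b' - b) u)).1
        nlinarith [mul_le_mul_of_nonneg_right hb' (norm_nonneg u)]
      rw [inner_sub_left] at hin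
      have h4 := (abs_le.mp ha').2
      linarith
    have hlim : Tendsto (fun η : ℝ => η * (2 + 2 * ‖u‖ + (L x u + 1))) (𝓝[>] 0) (𝓝 0) := by
      have : Continuous fun η : ℝ => η * (2 + 2 * ‖u‖ + (L x u + 1)) := by fun_prop
      simpa using (this.tendsto 0).mono_left nhdsWithin_le_nhds
    have := ge_of_tendsto hlim (by
      filter_upwards [self_mem_nhdsWithin] with η hη using key η hη)
    simp only
    linarith
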